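/- arXiv:1303.0806 — 10 statements merged into one kernel-verified Lean document; each statement's English description precedes it below -/
import Mathlib

section
/- Let m ≥ 0. Then c m = c₀ · (the sum, over all integers N with 0 ≤ N ≤ m and N ≡ m (mod 2), of T_N((m-N)/2)). In particular every coefficient of the solution of the three-term recurrence relation is an explicit finite sum of products of the A's and B's, with the summands grouped by the number N of A-factors they contain. -/
/-- `T A B N n` is the nested sum `T_N(n)`:
for `N = 0` it is `∏_{j=0}^{n-1} B (2j+1)`, and for `N ≥ 1` it is the sum over all
nondecreasing tuples `0 ≤ i_1 ≤ ⋯ ≤ i_N ≤ n` of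
`(∏_{k=1}^{N} A (2 i_k + k - 1)) * (∏_{l=0}^{N-1} ∏_{j=i_l}^{i_{l+1}-1} B (2j+l+1)) *
 (∏_{j=i_N}^{n-1} B (2j+N+1))` with the convention `i_0 = 0`. -/
def T {R : Type*} [CommRing R] (A B : ℕ → R) : ℕ → ℕ → R
  | 0, n => ∏ j ∈ Finset.range n, B (2 * j + 1)
  | N + 1, n =>
      ∑ i ∈ Finset.univ.filter
          (fun i : Fin (N + 1) → Fin (n + 1) => ∀ a b, a ≤ b → i a ≤ i b),
        (fun e : ℕ → ℕ =>
          (∏ k ∈ Finset.range (N + 1), A (2 * e (k + 1) + k)) *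
          (∏ l ∈ Finset.range (N + 1), ∏ j ∈ Finset.Ico (e l) (e (l + 1)), B (2 * j + l + 1)) *
          (∏ j ∈ Finset.Ico (e (N + 1)) n, B (2 * j + (N + 1) + 1)))
        (fun l => if h : 1 ≤ l ∧ l ≤ N + 1 then (i ⟨l - 1, by omega⟩ : ℕ) else 0)

/-- The sequence `0, i_1, …, i_N, 0, 0, …` attached to a tuple `i`. -/
def extendTuple {N n : ℕ} (i : Fin N → Fin (n + 1)) (l : ℕ) : ℕ :=
  if h : 1 ≤ l ∧ l ≤ N then (i ⟨l - 1, by omega⟩ : ℕ) else 0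

/-- The summand of `T A B N n` attached to a sequence of indices `e`. -/
def tupleWeight {R : Type*} [CommRing R] (A B : ℕ → R) (N n : ℕ) (e : ℕ → ℕ) : R :=
  (∏ k ∈ Finset.range N, A (2 * e (k + 1) + k)) *
    (∏ l ∈ Finset.range N, ∏ j ∈ Finset.Ico (e l) (e (l + 1)), B (2 * j + l + 1)) *
    (∏ j ∈ Finset.Ico (e N) n, B (2 * j + N + 1))

theorem tupleWeight_congr {R : Type*} [CommRing R] (A B : ℕ → R) (N n : ℕ) {e f : ℕ → ℕ}
    (h : ∀ l ≤ N, e l = f l) : tupleWeight A B N n e = tupleWeight A B N n f := by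
  unfold tupleWeight
  rw [h N le_rfl]
  congr 2
  · refine Finset.prod_congr rfl fun k hk => ?_
    rw [h (k + 1) (Finset.mem_range.1 hk)]
  · refine Finset.prod_congr rfl fun k hk => ?_
    rw [h (k + 1) (Finset.mem_range.1 hk), h k (Finset.mem_range.1 hk).le]

theorem tupleWeight_succ {R : Type*} [CommRing R] (A B : ℕ → R) (N n : ℕ) (e : ℕ → ℕ) :
    tupleWeight A B (N + 1) n e = tupleWeight A B N (e (N + 1)) e * A (2 * e (N + 1) + N) *
      ∏ j ∈ Finset.Ico (e (N + 1)) n, B (2 * j + N + 2) := by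
  simp only [tupleWeight, Finset.prod_range_succ, ← add_assoc]
  ring

theorem T_eq_sum_tupleWeight {R : Type*} [CommRing R] (A B : ℕ → R) (N n : ℕ) :
    T A B N n = ∑ i : Fin N → Fin (n + 1) with ∀ a b, a ≤ b → i a ≤ i b,
      tupleWeight A B N n (extendTuple i) := by
  cases N with
  | zero => simp [T, tupleWeight, extendTuple]
  | succ N => rfl

theorem T_succ_eq_sum {R : Type*} [CommRing R] (A B : ℕ → R) (N n : ℕ) :
    T A B (N + 1) n = ∑ s ∈ Finset.range (n + 1), T A B N s * A (2 * s + N) *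
      ∏ j ∈ Finset.Ico s n, B (2 * j + N + 2) := by
  rw [T_eq_sum_tupleWeight, Finset.sum_range,
    ← Finset.sum_fiberwise _ (fun i : Fin (N + 1) → Fin (n + 1) => i (Fin.last N))]
  refine Finset.sum_congr rfl fun s _ => ?_
  rw [T_eq_sum_tupleWeight, Finset.sum_mul, Finset.sum_mul]
  have hs : (s : ℕ) + 1 ≤ n + 1 := s.2
  refine Finset.sum_bij'
    (fun i _ k => ⟨min (i k.castSucc : ℕ) s, by omega⟩)
    (fun i _ => Fin.snoc (α := fun _ => Fin (n + 1)) (fun k => Fin.castLE hs (i k)) s)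
    ?_ ?_ ?_ ?_ ?_
  · intro i hi
    simp only [Finset.mem_filter, Finset.mem_univ, true_and] at hi ⊢
    intro a b hab
    have := hi.1 a.castSucc b.castSucc hab
    simp only [Fin.le_def] at this ⊢
    omega
  · intro i hi
    simp only [Finset.mem_filter, Finset.mem_univ, true_and] at hi ⊢
    refine ⟨fun a b hab => ?_, by simp⟩
    induction b using Fin.lastCases with
    | last =>
      induction a using Fin.lastCases with
      | last => exact le_rfl
      | cast a =>
        have := (i a).2
        simp only [Fin.snoc_castSucc, Fin.snoc_last, Fin.le_def, Fin.val_castLE]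
        omega
    | cast b =>
      induction a using Fin.lastCases with
      | last =>
        have := b.2
        simp only [Fin.le_def, Fin.val_last, Fin.val_castSucc] at hab
        omega
      | cast a => simpa only [Fin.snoc_castSucc, Fin.le_def, Fin.val_castLE] using hi a b hab
  · intro i hi
    simp only [Finset.mem_filter, Finset.mem_univ, true_and] at hi
    funext k
    induction k using Fin.lastCases with
    | last => simp [hi.2]
    | cast k =>
      have := hi.1 k.castSucc (Fin.last N) (Fin.le_last _)
      rw [hi.2, Fin.le_def] at this
      simp [this]
  · intro i _
    funext k
    have := (i k).2
    simp only [Fin.snoc_castSucc, Fin.ext_iff, Fin.val_castLE]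
    omega
  · intro i hi
    simp only [Finset.mem_filter, Finset.mem_univ, true_and] at hi
    have hlast : extendTuple i (N + 1) = s := by
      rw [← hi.2]
      simp [extendTuple, Fin.last]
    rw [tupleWeight_succ, hlast]
    congr 2
    refine tupleWeight_congr A B N s fun l hl => ?_
    by_cases h : 1 ≤ l
    · have := hi.1 (Fin.castSucc ⟨l - 1, by omega⟩) (Fin.last N) (Fin.le_last _)
      rw [hi.2, Fin.le_def] at this
      simp only [extendTuple, h, hl, hl.trans N.le_succ, and_self, dite_true]
      exact (min_eq_left this).symm
    · simp [extendTuple, h]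

theorem T_zero_zero {R : Type*} [CommRing R] (A B : ℕ → R) : T A B 0 0 = 1 := by
  simp [T]

theorem T_zero_succ {R : Type*} [CommRing R] (A B : ℕ → R) (n : ℕ) :
    T A B 0 (n + 1) = B (2 * n + 1) * T A B 0 n := by
  simp only [T, Finset.prod_range_succ, mul_comm]

theorem T_succ_zero {R : Type*} [CommRing R] (A B : ℕ → R) (N : ℕ) :
    T A B (N + 1) 0 = A N * T A B N 0 := by
  simp [T_succ_eq_sum A B N 0, mul_comm]

theorem T_succ_succ {R : Type*} [CommRing R] (A B : ℕ → R) (N n : ℕ) :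
    T A B (N + 1) (n + 1) =
      A (2 * (n + 1) + N) * T A B N (n + 1) + B (2 * n + N + 2) * T A B (N + 1) n := by
  rw [T_succ_eq_sum A B N (n + 1), T_succ_eq_sum A B N n, Finset.sum_range_succ, Finset.mul_sum,
    add_comm]
  congr 1
  · simp [mul_comm]
  · refine Finset.sum_congr rfl fun s hs => ?_
    rw [Finset.prod_Ico_succ_top (Nat.lt_succ_iff.1 (Finset.mem_range.1 hs))]
    ring

/-- The contribution to `c m` of the terms with exactly `N` factors `A`. -/
def gradedPart {R : Type*} [CommRing R] (A B : ℕ → R) (N m : ℕ) : R :=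
  if N ≤ m ∧ N % 2 = m % 2 then T A B N ((m - N) / 2) else 0

theorem gradedPart_of_lt {R : Type*} [CommRing R] (A B : ℕ → R) {N m : ℕ} (h : m < N) :
    gradedPart A B N m = 0 :=
  if_neg fun h' => h.not_ge h'.1

theorem gradedPart_add_two_mul {R : Type*} [CommRing R] (A B : ℕ → R) (N n : ℕ) :
    gradedPart A B N (2 * n + N) = T A B N n := by
  rw [gradedPart, if_pos (by omega)]
  congr 1
  omega

theorem gradedPart_of_mod_ne {R : Type*} [CommRing R] (A B : ℕ → R) {N m : ℕ}
    (h : N % 2 ≠ m % 2) : gradedPart A B N m = 0 :=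
  if_neg fun h' => h h'.2

theorem gradedPart_zero_add_two {R : Type*} [CommRing R] (A B : ℕ → R) (m : ℕ) :
    gradedPart A B 0 (m + 2) = B (m + 1) * gradedPart A B 0 m := by
  by_cases h : 0 % 2 = m % 2
  · obtain ⟨n, rfl⟩ : ∃ n, m = 2 * n + 0 := ⟨m / 2, by omega⟩
    rw [gradedPart_add_two_mul, show 2 * n + 0 + 2 = 2 * (n + 1) + 0 by ring,
      gradedPart_add_two_mul, T_zero_succ]
  · rw [gradedPart_of_mod_ne A B h, gradedPart_of_mod_ne A B (by omega), mul_zero]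

theorem gradedPart_succ_add_two {R : Type*} [CommRing R] (A B : ℕ → R) (N m : ℕ) :
    gradedPart A B (N + 1) (m + 2) =
      A (m + 1) * gradedPart A B N (m + 1) + B (m + 1) * gradedPart A B (N + 1) m := by
  by_cases h : N ≤ m + 1 ∧ N % 2 = (m + 1) % 2
  · obtain ⟨n, hn⟩ : ∃ n, m + 1 = 2 * n + N := ⟨(m + 1 - N) / 2, by omega⟩
    rw [show m + 2 = 2 * n + (N + 1) by omega, hn, gradedPart_add_two_mul, gradedPart_add_two_mul]
    cases n with
    | zero => rw [T_succ_zero, gradedPart_of_lt A B (by omega), mul_zero, mul_zero, add_zero,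
        zero_add]
    | succ n =>
      rw [T_succ_succ, show m = 2 * n + (N + 1) by omega, gradedPart_add_two_mul,
        show 2 * (n + 1) + N = 2 * n + N + 2 by ring]
  · rw [gradedPart, gradedPart, gradedPart, if_neg (by omega), if_neg h, if_neg (by omega)]
    simp

theorem sum_T_eq_sum_gradedPart {R : Type*} [CommRing R] (A B : ℕ → R) {m K : ℕ} (h : m < K) :
    ∑ N ∈ (Finset.range (m + 1)).filter (fun N => N % 2 = m % 2), T A B N ((m - N) / 2) =
      ∑ N ∈ Finset.range K, gradedPart A B N m := by
  rw [← Finset.sum_subset (Finset.range_mono h : Finset.range (m + 1) ⊆ Finset.range K)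
    fun N _ hN => gradedPart_of_lt A B (by simpa [Nat.lt_succ_iff] using hN), Finset.sum_filter]
  refine Finset.sum_congr rfl fun N hN => ?_
  simp [gradedPart, Nat.lt_succ_iff.1 (Finset.mem_range.1 hN)]

theorem sum_gradedPart_add_two {R : Type*} [CommRing R] (A B : ℕ → R) (m : ℕ) :
    ∑ N ∈ Finset.range (m + 3), gradedPart A B N (m + 2) =
      A (m + 1) * ∑ N ∈ Finset.range (m + 2), gradedPart A B N (m + 1) +
        B (m + 1) * ∑ N ∈ Finset.range (m + 3), gradedPart A B N m := by
  rw [Finset.sum_range_succ', Finset.sum_range_succ' (fun N => gradedPart A B N m),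
    gradedPart_zero_add_two, Finset.sum_congr rfl fun N _ => gradedPart_succ_add_two A B N m,
    Finset.sum_add_distrib, Finset.mul_sum, mul_add, Finset.mul_sum, add_assoc]

/-- Every coefficient `c m` of the solution of the three-term recurrence relation is
`c₀` times the finite sum of the `T_N((m-N)/2)` over those `0 ≤ N ≤ m` with `N ≡ m (mod 2)`. -/
theorem three_term_recurrence_coeff_eq_sum_T
    {R : Type*} [CommRing R] (A B : ℕ → R) (c₀ : R) (c : ℕ → R)
    (h0 : c 0 = c₀) (h1 : c 1 = A 0 * c₀)
    (hrec : ∀ n, 1 ≤ n → c (n + 1) = A n * c n + B n * c (n - 1)) (m : ℕ) :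
    c m = c₀ * ∑ N ∈ (Finset.range (m + 1)).filter (fun N => N % 2 = m % 2),
      T A B N ((m - N) / 2) := by
  induction m using Nat.twoStepInduction with
  | zero =>
    rw [sum_T_eq_sum_gradedPart A B zero_lt_one]
    simp [gradedPart, T_zero_zero, h0]
  | one =>
    rw [sum_T_eq_sum_gradedPart A B (Nat.lt_succ_self 1), Finset.sum_range_succ, Finset.sum_range_one]
    simp [gradedPart, T_succ_zero, T_zero_zero, h1, mul_comm]
  | more m ih ih' =>
    rw [hrec (m + 1) (Nat.le_add_left 1 m), Nat.add_sub_cancel, ih, ih',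
      sum_T_eq_sum_gradedPart A B (show m < m + 3 by omega),
      sum_T_eq_sum_gradedPart A B (Nat.lt_succ_self (m + 1)),
      sum_T_eq_sum_gradedPart A B (Nat.lt_succ_self (m + 2)), sum_gradedPart_add_two]
    ring
end

section
/- For all m ≥ 0 and N ≥ 0, if N > m or m - N is odd, then the coefficient of t^N in the polynomial P m is 0. That is, a coefficient of even (resp. odd) index in the solution of the three-term recurrence relation contains only summands with an even (resp. odd) number of A-factors, and at most m of them. -/
/-- A coefficient of even (resp. odd) index of the solution of the three-term recurrence
relation contains only summands with an even (resp. odd) number of `A`-factors, and at most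
`m` of them: if `N > m` or `m - N` is odd, the coefficient of `t^N` in `P m` vanishes. -/
theorem three_term_recurrence_graded_coeff_vanish
    {R : Type*} [CommRing R] (A B : ℕ → R) (c₀ : R) (P : ℕ → Polynomial R)
    (h0 : P 0 = Polynomial.C c₀)
    (h1 : P 1 = Polynomial.X * Polynomial.C (A 0 * c₀))
    (hrec : ∀ n, 1 ≤ n →
      P (n + 1) = Polynomial.X * Polynomial.C (A n) * P n + Polynomial.C (B n) * P (n - 1))
    (m N : ℕ) (hNm : m < N ∨ Odd (m - N)) :
    (P m).coeff N = 0 := by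
  induction m using Nat.strong_induction_on generalizing N with
  | _ m ih =>
    match m, ih, hNm with
    | 0, _, hNm =>
      rw [h0, Polynomial.coeff_C_of_ne_zero]
      grind
    | 1, _, hNm =>
      rw [h1, Polynomial.X_mul_C, Polynomial.coeff_C_mul_X, if_neg]
      grind
    | k + 2, ih, hNm =>
      have hlow : (P k).coeff N = 0 := ih k (by omega) N (by grind)
      rw [hrec (k + 1) (by omega), Polynomial.coeff_add, mul_assoc, Polynomial.coeff_C_mul,
        Nat.add_sub_cancel, hlow, mul_zero, add_zero]
      cases N with
      | zero => exact Polynomial.coeff_X_mul_zero _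
      | succ j =>
        rw [Polynomial.coeff_X_mul, Polynomial.coeff_C_mul,
          ih (k + 1) (by omega) j (by grind), mul_zero]
end

section
/- For all n ≥ 0, the coefficient of t^0 (the constant coefficient) of the polynomial P (2n) equals c₀ · ∏_{j=0}^{n-1} B_{2j+1}. That is, the part of the solution of the three-term recurrence relation containing no A-factors is the product B_1 B_3 ⋯ B_{2n-1} times c₀, appearing at even index 2n. -/
/-- The part of the solution of the three-term recurrence relation containing no `A`-factors:
the constant coefficient of `P (2n)` equals `c₀ * B 1 * B 3 * ⋯ * B (2n-1)`. -/
theorem three_term_recurrence_zero_A_terms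
    {R : Type*} [CommRing R] (A B : ℕ → R) (c₀ : R) (P : ℕ → Polynomial R)
    (h0 : P 0 = Polynomial.C c₀)
    (h1 : P 1 = Polynomial.X * Polynomial.C (A 0 * c₀))
    (hrec : ∀ n, 1 ≤ n →
      P (n + 1) = Polynomial.X * Polynomial.C (A n) * P n + Polynomial.C (B n) * P (n - 1))
    (n : ℕ) :
    (P (2 * n)).coeff 0 = c₀ * ∏ j ∈ Finset.range n, B (2 * j + 1) := by
  induction n with
  | zero => simp [h0]
  | succ k ih =>
    rw [show 2 * (k + 1) = 2 * k + 1 + 1 by ring, hrec _ (Nat.le_add_left 1 _),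
      Nat.add_sub_cancel, Finset.prod_range_succ]
    simp only [Polynomial.coeff_add, Polynomial.mul_coeff_zero, Polynomial.coeff_X_zero,
      Polynomial.coeff_C_zero, ih]
    ring
end

section
/- For all n ≥ 0, the coefficient of t^1 in the polynomial P (2n+1) equals c₀ · Σ_{i=0}^{n} A_{2i} · (∏_{j=0}^{i-1} B_{2j+1}) · (∏_{j=i}^{n-1} B_{2j+2}). That is, the part of the solution of the three-term recurrence relation containing exactly one A-factor appears at odd index 2n+1 and is given by this single sum. -/
/-- The part of the solution without `A`-factors at an even index. -/
theorem three_term_recurrence_coeff_zero_even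
    {R : Type*} [CommRing R] (A B : ℕ → R) (c₀ : R) (P : ℕ → Polynomial R)
    (h0 : P 0 = Polynomial.C c₀)
    (hrec : ∀ n, 1 ≤ n →
      P (n + 1) = Polynomial.X * Polynomial.C (A n) * P n + Polynomial.C (B n) * P (n - 1))
    (n : ℕ) :
    (P (2 * n)).coeff 0 = c₀ * ∏ j ∈ Finset.range n, B (2 * j + 1) := by
  induction n with
  | zero => simp [h0]
  | succ n ih =>
    rw [show 2 * (n + 1) = 2 * n + 1 + 1 by ring, hrec _ (by omega), Finset.prod_range_succ,
      Nat.add_sub_cancel, mul_assoc, Polynomial.coeff_add, Polynomial.coeff_X_mul_zero,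
      Polynomial.coeff_C_mul, ih]
    ring

/-- The part of the solution of the three-term recurrence relation containing exactly one
`A`-factor: the coefficient of `t^1` in `P (2n+1)` equals
`c₀ * Σ_{i=0}^{n} A (2i) * (∏_{j=0}^{i-1} B (2j+1)) * (∏_{j=i}^{n-1} B (2j+2))`. -/
theorem three_term_recurrence_one_A_term
    {R : Type*} [CommRing R] (A B : ℕ → R) (c₀ : R) (P : ℕ → Polynomial R)
    (h0 : P 0 = Polynomial.C c₀)
    (h1 : P 1 = Polynomial.X * Polynomial.C (A 0 * c₀))
    (hrec : ∀ n, 1 ≤ n →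
      P (n + 1) = Polynomial.X * Polynomial.C (A n) * P n + Polynomial.C (B n) * P (n - 1))
    (n : ℕ) :
    (P (2 * n + 1)).coeff 1 =
      c₀ * ∑ i ∈ Finset.range (n + 1),
        A (2 * i) * (∏ j ∈ Finset.range i, B (2 * j + 1)) *
          ∏ j ∈ Finset.Ico i n, B (2 * j + 2) := by
  induction n with
  | zero => simp [h1, mul_comm]
  | succ n ih =>
    have hsum : ∑ i ∈ Finset.range (n + 1), A (2 * i) * (∏ j ∈ Finset.range i, B (2 * j + 1)) *
          ∏ j ∈ Finset.Ico i (n + 1), B (2 * j + 2) =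
        (∑ i ∈ Finset.range (n + 1), A (2 * i) * (∏ j ∈ Finset.range i, B (2 * j + 1)) *
          ∏ j ∈ Finset.Ico i n, B (2 * j + 2)) * B (2 * n + 2) := by
      rw [Finset.sum_mul]
      refine Finset.sum_congr rfl fun i hi => ?_
      rw [Finset.prod_Ico_succ_top (Nat.lt_succ_iff.mp (Finset.mem_range.mp hi)), ← mul_assoc]
    rw [hrec _ (by omega), show 2 * (n + 1) - 1 = 2 * n + 1 by omega, mul_assoc,
      Polynomial.coeff_add, Polynomial.coeff_X_mul, Polynomial.coeff_C_mul, Polynomial.coeff_C_mul,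
      three_term_recurrence_coeff_zero_even A B c₀ P h0 hrec, ih, Finset.sum_range_succ _ (n + 1),
      hsum, Finset.Ico_self, Finset.prod_empty, show 2 * (n + 1) = 2 * n + 2 by ring]
    ring
end

section
/- For all n ≥ 0, the coefficient of t^3 in the polynomial P (2n+3) equals c₀ · Σ_{i₁=0}^{n} Σ_{i₂=i₁}^{n} Σ_{i₃=i₂}^{n} A_{2i₁} · A_{2i₂+1} · A_{2i₃+2} · (∏_{j=0}^{i₁-1} B_{2j+1}) · (∏_{j=i₁}^{i₂-1} B_{2j+2}) · (∏_{j=i₂}^{i₃-1} B_{2j+3}) · (∏_{j=i₃}^{n-1} B_{2j+4}). That is, the part of the solution of the three-term recurrence relation containing exactly three A-factors appears at odd index 2n+3 and is given by this triple sum. -/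
/-- Closed form of the solution of the inhomogeneous first-order linear recurrence
`u (k + 1) = f (k + 1) + b k * u k` with `u 0 = f 0`. -/
theorem eq_sum_mul_prod_of_first_order_recurrence {R : Type*} [CommRing R] (u f b : ℕ → R)
    (h0 : u 0 = f 0) (hs : ∀ k, u (k + 1) = f (k + 1) + b k * u k) (n : ℕ) :
    u n = ∑ i ∈ Finset.range (n + 1), f i * ∏ j ∈ Finset.Ico i n, b j := by
  induction n with
  | zero => simp [h0]
  | succ n ih =>
    rw [hs, ih, Finset.sum_range_succ _ (n + 1), Finset.mul_sum, add_comm]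
    congr 1
    · refine Finset.sum_congr rfl fun i hi => ?_
      rw [Finset.prod_Ico_succ_top (Nat.lt_succ_iff.mp (Finset.mem_range.mp hi))]
      ring
    · simp

/-- Reversal of the order of summation over `i₁ ≤ i₂ ≤ i₃ ≤ n`. -/
theorem sum_range_sum_Icc_sum_Icc_comm {M : Type*} [AddCommMonoid M] (n : ℕ)
    (F : ℕ → ℕ → ℕ → M) :
    ∑ i₁ ∈ Finset.range (n + 1), ∑ i₂ ∈ Finset.Icc i₁ n, ∑ i₃ ∈ Finset.Icc i₂ n, F i₁ i₂ i₃ =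
      ∑ i₃ ∈ Finset.range (n + 1), ∑ i₂ ∈ Finset.range (i₃ + 1), ∑ i₁ ∈ Finset.range (i₂ + 1),
        F i₁ i₂ i₃ := by
  rw [Finset.sum_comm' (t' := Finset.range (n + 1)) (s' := fun i₂ => Finset.range (i₂ + 1))
    (by intro x y; simp only [Finset.mem_range, Finset.mem_Icc]; omega)]
  simp_rw [Finset.sum_comm (s := Finset.range _) (t := Finset.Icc _ n)]
  exact Finset.sum_comm' (by intro x y; simp only [Finset.mem_range, Finset.mem_Icc]; omega)

/-- The part of the solution of the three-term recurrence relation containing exactly three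
`A`-factors: the coefficient of `t^3` in `P (2n+3)` is the triple sum
`c₀ * Σ_{i₁=0}^{n} Σ_{i₂=i₁}^{n} Σ_{i₃=i₂}^{n} A (2i₁) * A (2i₂+1) * A (2i₃+2) *
 (∏_{j=0}^{i₁-1} B (2j+1)) * (∏_{j=i₁}^{i₂-1} B (2j+2)) * (∏_{j=i₂}^{i₃-1} B (2j+3)) *
 (∏_{j=i₃}^{n-1} B (2j+4))`. -/
theorem three_term_recurrence_three_A_terms
    {R : Type*} [CommRing R] (A B : ℕ → R) (c₀ : R) (P : ℕ → Polynomial R)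
    (h0 : P 0 = Polynomial.C c₀)
    (h1 : P 1 = Polynomial.X * Polynomial.C (A 0 * c₀))
    (hrec : ∀ n, 1 ≤ n →
      P (n + 1) = Polynomial.X * Polynomial.C (A n) * P n + Polynomial.C (B n) * P (n - 1))
    (n : ℕ) :
    (P (2 * n + 3)).coeff 3 =
      c₀ * ∑ i₁ ∈ Finset.range (n + 1), ∑ i₂ ∈ Finset.Icc i₁ n, ∑ i₃ ∈ Finset.Icc i₂ n,
        A (2 * i₁) * A (2 * i₂ + 1) * A (2 * i₃ + 2) *
          (∏ j ∈ Finset.range i₁, B (2 * j + 1)) *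
          (∏ j ∈ Finset.Ico i₁ i₂, B (2 * j + 2)) *
          (∏ j ∈ Finset.Ico i₂ i₃, B (2 * j + 3)) *
          ∏ j ∈ Finset.Ico i₃ n, B (2 * j + 4) := by
  have coeff_zero (m : ℕ) : (P (m + 2)).coeff 0 = B (m + 1) * (P m).coeff 0 := by
    rw [hrec (m + 1) (by omega)]
    simp [mul_assoc]
  have coeff_succ (m d : ℕ) : (P (m + 2)).coeff (d + 1) =
      A (m + 1) * (P (m + 1)).coeff d + B (m + 1) * (P m).coeff (d + 1) := by
    rw [hrec (m + 1) (by omega)]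
    simp [mul_assoc]
  have e0 (k : ℕ) : (P (2 * k)).coeff 0 = c₀ * ∏ j ∈ Finset.range k, B (2 * j + 1) := by
    induction k with
    | zero => simp [h0]
    | succ k ih =>
      rw [Nat.mul_succ, coeff_zero, ih, Finset.prod_range_succ]
      ring
  have e1 := eq_sum_mul_prod_of_first_order_recurrence (fun k => (P (2 * k + 1)).coeff 1)
    (fun k => A (2 * k) * (P (2 * k)).coeff 0) (fun k => B (2 * k + 2))
    (by simp [h0, h1]) (fun k => coeff_succ (2 * k + 1) 0)
  have e2 := eq_sum_mul_prod_of_first_order_recurrence (fun k => (P (2 * k + 2)).coeff 2)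
    (fun k => A (2 * k + 1) * (P (2 * k + 1)).coeff 1) (fun k => B (2 * k + 3))
    (by simp [coeff_succ 0 1, h0]) (fun k => coeff_succ (2 * k + 2) 1)
  have e3 := eq_sum_mul_prod_of_first_order_recurrence (fun k => (P (2 * k + 3)).coeff 3)
    (fun k => A (2 * k + 2) * (P (2 * k + 2)).coeff 2) (fun k => B (2 * k + 4))
    (by simp [coeff_succ 1 2, h1]) (fun k => coeff_succ (2 * k + 3) 2)
  rw [e3, sum_range_sum_Icc_sum_Icc_comm]
  simp only [e2, e1, e0, Finset.mul_sum, Finset.sum_mul]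
  refine Finset.sum_congr rfl fun i₃ _ => Finset.sum_congr rfl fun i₂ _ =>
    Finset.sum_congr rfl fun i₁ _ => ?_
  ring
end

section
/- Let N ≥ 0 and let β : ℕ → ℕ be nondecreasing with B (2·β k + k + 1) = 0 for every k ≤ N. Then for every n > β N, the coefficient of t^N in the polynomial P (2n+N) equals 0. That is, when each sequence of B-terms is terminated by the eigenvalues β_0 ≤ β_1 ≤ ⋯ ≤ β_N, the part of the solution of the three-term recurrence relation containing exactly N A-factors is a polynomial: its coefficients vanish beyond index 2·β_N + N. -/
/-- Polynomial case: if the `B`-terms are terminated by nondecreasing eigenvalues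
`β 0 ≤ β 1 ≤ ⋯ ≤ β N` (i.e. `B (2 * β k + k + 1) = 0` for every `k ≤ N`), then the part of the
solution of the three-term recurrence relation containing exactly `N` `A`-factors vanishes
beyond index `2 * β N + N`: for `n > β N` the coefficient of `t^N` in `P (2n+N)` is zero. -/
theorem three_term_recurrence_polynomial_termination
    {R : Type*} [CommRing R] (A B : ℕ → R) (c₀ : R) (P : ℕ → Polynomial R)
    (h0 : P 0 = Polynomial.C c₀)
    (h1 : P 1 = Polynomial.X * Polynomial.C (A 0 * c₀))
    (hrec : ∀ n, 1 ≤ n →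
      P (n + 1) = Polynomial.X * Polynomial.C (A n) * P n + Polynomial.C (B n) * P (n - 1))
    (N : ℕ) (β : ℕ → ℕ) (hβmono : Monotone β)
    (hβ : ∀ k ≤ N, B (2 * β k + k + 1) = 0)
    (n : ℕ) (hn : β N < n) :
    (P (2 * n + N)).coeff N = 0 := by
  induction N generalizing n with
  | zero =>
    induction n, hn using Nat.le_induction with
    | base =>
      rw [show 2 * (β 0).succ + 0 = (2 * β 0 + 0 + 1) + 1 by omega, hrec _ (by omega),
        hβ 0 le_rfl]
      simp [mul_assoc]
    | succ n hn ih =>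
      rw [show 2 * (n + 1) + 0 = (2 * n + 1) + 1 by omega, hrec _ (by omega),
        show 2 * n + 1 - 1 = 2 * n + 0 by omega, mul_assoc, Polynomial.coeff_add,
        Polynomial.coeff_C_mul, ih, Polynomial.mul_coeff_zero]
      simp
  | succ N ihN =>
    have lower (m : ℕ) (hm : β (N + 1) < m) : (P (2 * m + N)).coeff N = 0 :=
      ihN (fun k hk => hβ k (by omega)) m ((hβmono N.le_succ).trans_lt hm)
    induction n, hn using Nat.le_induction with
    | base =>
      rw [show 2 * (β (N + 1)).succ + (N + 1) = (2 * β (N + 1) + (N + 1) + 1) + 1 by omega,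
        hrec _ (by omega), hβ (N + 1) le_rfl, mul_assoc, Polynomial.coeff_add,
        Polynomial.coeff_X_mul, Polynomial.coeff_C_mul,
        show 2 * β (N + 1) + (N + 1) + 1 = 2 * (β (N + 1) + 1) + N by omega,
        lower _ (Nat.lt_succ_self _)]
      simp
    | succ n hn ih =>
      rw [show 2 * (n + 1) + (N + 1) = (2 * (n + 1) + N) + 1 by omega, hrec _ (by omega),
        show 2 * (n + 1) + N - 1 = 2 * n + (N + 1) by omega, mul_assoc, Polynomial.coeff_add,
        Polynomial.coeff_X_mul, Polynomial.coeff_C_mul, Polynomial.coeff_C_mul, ih,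
        lower (n + 1) (by omega)]
      simp
end

section
/- Suppose β₀ ∈ ℕ satisfies B (2·β₀ + 1) = 0. Then for every n ≥ 0, the coefficient of t^1 in the polynomial P (2n+1) equals c₀ · Σ_{i=0}^{min(n, β₀)} A_{2i} · (∏_{j=0}^{i-1} B_{2j+1}) · (∏_{j=i}^{n-1} B_{2j+2}). That is, when the odd-indexed B-sequence is terminated at β₀, the one-A-factor part of the solution of the three-term recurrence relation is given by a sum truncated at β₀. -/
open Polynomial in
theorem coeff_zero_even_of_three_term_recurrence {R : Type*} [CommRing R] {A B : ℕ → R} {c₀ : R}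
    {P : ℕ → R[X]} (h0 : P 0 = C c₀)
    (hrec : ∀ n, 1 ≤ n → P (n + 1) = X * C (A n) * P n + C (B n) * P (n - 1)) (n : ℕ) :
    (P (2 * n)).coeff 0 = c₀ * ∏ j ∈ Finset.range n, B (2 * j + 1) := by
  induction n with
  | zero => simp [h0]
  | succ n ih =>
    rw [show 2 * (n + 1) = 2 * n + 1 + 1 by ring, hrec _ (by omega), Nat.add_sub_cancel,
      Finset.prod_range_succ, mul_assoc X, coeff_add, coeff_X_mul_zero, coeff_C_mul, ih]
    ring

open Polynomial in
theorem coeff_one_odd_of_three_term_recurrence {R : Type*} [CommRing R] {A B : ℕ → R} {c₀ : R}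
    {P : ℕ → R[X]} (h0 : P 0 = C c₀) (h1 : P 1 = X * C (A 0 * c₀))
    (hrec : ∀ n, 1 ≤ n → P (n + 1) = X * C (A n) * P n + C (B n) * P (n - 1)) (n : ℕ) :
    (P (2 * n + 1)).coeff 1 =
      c₀ * ∑ i ∈ Finset.range (n + 1),
        A (2 * i) * (∏ j ∈ Finset.range i, B (2 * j + 1)) *
          ∏ j ∈ Finset.Ico i n, B (2 * j + 2) := by
  induction n with
  | zero =>
    rw [Nat.mul_zero, Nat.zero_add, h1, coeff_X_mul, coeff_C_zero]
    simp [mul_comm]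
  | succ n ih =>
    have hsum : ∑ i ∈ Finset.range (n + 1),
        A (2 * i) * (∏ j ∈ Finset.range i, B (2 * j + 1)) *
          ∏ j ∈ Finset.Ico i (n + 1), B (2 * j + 2) =
        (∑ i ∈ Finset.range (n + 1),
          A (2 * i) * (∏ j ∈ Finset.range i, B (2 * j + 1)) *
            ∏ j ∈ Finset.Ico i n, B (2 * j + 2)) * B (2 * n + 2) := by
      rw [Finset.sum_mul]
      refine Finset.sum_congr rfl fun i hi => ?_
      rw [Finset.prod_Ico_succ_top (Nat.lt_succ_iff.mp (Finset.mem_range.mp hi)), mul_assoc _ _ (B _)]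
    rw [Finset.sum_range_succ, hsum, Finset.Ico_self, Finset.prod_empty,
      hrec (2 * (n + 1)) (by omega), mul_assoc X, coeff_add, coeff_X_mul, coeff_C_mul, coeff_C_mul,
      coeff_zero_even_of_three_term_recurrence h0 hrec,
      show 2 * (n + 1) - 1 = 2 * n + 1 by omega, ih, show 2 * (n + 1) = 2 * n + 2 by ring]
    ring


/-- Polynomial case with one `A`-factor: if the odd-indexed `B`-sequence is terminated at
`β₀` (i.e. `B (2 * β₀ + 1) = 0`), then the coefficient of `t^1` in `P (2n+1)` equals
`c₀ * Σ_{i=0}^{min n β₀} A (2i) * (∏_{j=0}^{i-1} B (2j+1)) * (∏_{j=i}^{n-1} B (2j+2))`. -/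
theorem three_term_recurrence_one_A_term_truncated
    {R : Type*} [CommRing R] (A B : ℕ → R) (c₀ : R) (P : ℕ → Polynomial R)
    (h0 : P 0 = Polynomial.C c₀)
    (h1 : P 1 = Polynomial.X * Polynomial.C (A 0 * c₀))
    (hrec : ∀ n, 1 ≤ n →
      P (n + 1) = Polynomial.X * Polynomial.C (A n) * P n + Polynomial.C (B n) * P (n - 1))
    (β₀ : ℕ) (hβ₀ : B (2 * β₀ + 1) = 0) (n : ℕ) :
    (P (2 * n + 1)).coeff 1 =
      c₀ * ∑ i ∈ Finset.range (min n β₀ + 1),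
        A (2 * i) * (∏ j ∈ Finset.range i, B (2 * j + 1)) *
          ∏ j ∈ Finset.Ico i n, B (2 * j + 2) := by
  rw [coeff_one_odd_of_three_term_recurrence h0 h1 hrec]
  congr 1
  symm
  refine Finset.sum_subset (Finset.range_mono (by omega)) fun i hi hi' => ?_
  rw [Finset.mem_range] at hi hi'
  rw [Finset.prod_eq_zero (Finset.mem_range.mpr (by omega : β₀ < i)) hβ₀, mul_zero, zero_mul]
end

section
/- Work in the multivariate polynomial ring ℤ[a_0, a_1, …, b_0, b_1, …] in two countable families of independent indeterminates (e.g. MvPolynomial (ℕ ⊕ ℕ) ℤ with a_i = X (inl i) and b_i = X (inr i)). Define c : ℕ → MvPolynomial (ℕ ⊕ ℕ) ℤ by c 0 = 1, c 1 = a_0, and c (n+1) = a_n * c n + b_n * c (n-1) for all n ≥ 1. Then for every n ≥ 0, the number of monomials of c n (the cardinality of its support) equals fib (n+1). That is, the number of individual terms in the expansion of the solution of the three-term recurrence relation follows the Fibonacci sequence 1, 1, 2, 3, 5, 8, 13, 21, 34, …. -/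
open MvPolynomial in
/-- If the variable `s` occurs in no monomial of `q` and `s ≠ t`, then no monomials merge in
`X s * p + X t * q`. -/
theorem MvPolynomial.card_support_X_mul_add_X_mul {σ R : Type*} [CommSemiring R] {s t : σ}
    (hst : s ≠ t) (p q : MvPolynomial σ R) (hq : s ∉ q.vars) :
    (X s * p + X t * q).support.card = p.support.card + q.support.card := by
  classical
  have hdisj : Disjoint (X s * p).support (X t * q).support := by
    rw [support_X_mul, support_X_mul, Finset.disjoint_left]
    intro d hp ht
    obtain ⟨e, -, rfl⟩ := Finset.mem_map.mp hp
    obtain ⟨f, hf, hfe⟩ := Finset.mem_map.mp ht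
    refine hq ((mem_vars_iff_mem_support s).mpr ⟨f, hf, ?_⟩)
    have h := DFunLike.congr_fun hfe s
    simp [hst.symm] at h
    simp [h]
  have hsupp : (X s * p + X t * q).support = (X s * p).support ∪ (X t * q).support :=
    Finsupp.support_add_eq hdisj
  rw [hsupp, Finset.card_union_of_disjoint hdisj, support_X_mul, support_X_mul,
    Finset.card_map, Finset.card_map]

/-- In the polynomial ring `ℤ[a₀, a₁, …, b₀, b₁, …]` (with `aᵢ = X (inl i)`,
`bᵢ = X (inr i)`), the solution of the three-term recurrence relation
`c 0 = 1`, `c 1 = a₀`, `c (n+1) = aₙ * c n + bₙ * c (n-1)` has exactly `fib (n+1)`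
monomials: the number of individual terms follows the Fibonacci sequence
`1, 1, 2, 3, 5, 8, 13, 21, 34, …`. -/
theorem three_term_recurrence_term_count_fibonacci
    (c : ℕ → MvPolynomial (ℕ ⊕ ℕ) ℤ)
    (h0 : c 0 = 1)
    (h1 : c 1 = MvPolynomial.X (Sum.inl 0))
    (hrec : ∀ n, 1 ≤ n → c (n + 1) =
      MvPolynomial.X (Sum.inl n) * c n + MvPolynomial.X (Sum.inr n) * c (n - 1)) :
    ∀ n, (c n).support.card = Nat.fib (n + 1) := by
  have hvars : ∀ n m, n ≤ m → Sum.inl m ∉ (c n).vars := by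
    intro n
    induction n using Nat.twoStepInduction with
    | zero => simp [h0]
    | one =>
      intro m hm
      rw [h1, MvPolynomial.vars_X, Finset.mem_singleton, Sum.inl.injEq]
      omega
    | more n ih ih' =>
      intro m hm hmem
      rw [hrec (n + 1) (by omega), Nat.add_sub_cancel] at hmem
      rcases Finset.mem_union.mp (MvPolynomial.vars_add_subset _ _ hmem) with h | h <;>
        rcases Finset.mem_union.mp (MvPolynomial.vars_mul _ _ h) with h | h
      · rw [MvPolynomial.vars_X, Finset.mem_singleton, Sum.inl.injEq] at h
        omega
      · exact ih' m (by omega) h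
      · simp [MvPolynomial.vars_X] at h
      · exact ih m (by omega) h
  intro n
  induction n using Nat.twoStepInduction with
  | zero => simp [h0, MvPolynomial.support_one]
  | one => simp [h1, MvPolynomial.support_X]
  | more n ih ih' =>
    rw [hrec (n + 1) (by omega), Nat.add_sub_cancel,
      MvPolynomial.card_support_X_mul_add_X_mul Sum.inl_ne_inr _ _ (hvars n (n + 1) (by omega)),
      ih, ih', Nat.fib_add_two (n := n + 1), Nat.add_comm]
end

section
/- Work in the multivariate polynomial ring in three countable families of independent indeterminates a_i, b_i, d_i over ℤ (e.g. MvPolynomial (Fin 3 × ℕ) ℤ). Define c : ℕ → this ring by c 0 = 1, c 1 = a_0, c 2 = a_0 * a_1 + b_1, and c (n+1) = a_n * c n + b_n * c (n-1) + d_n * c (n-2) for all n ≥ 2 (the four-term recurrence relation with seed values c_1 = A_0 c_0 and c_2 = (A_0 A_1 + B_1) c_0). Then for every n ≥ 0, the number of monomials of c n (the cardinality of its support) equals T n, where T 0 = 1, T 1 = 1, T 2 = 2, and T (n+1) = T n + T (n-1) + T (n-2) for n ≥ 2. That is, the number of individual terms in the solution of the four-term recurrence relation follows the Tribonacci numbers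 1, 1, 2, 4, 7, 13, 24, 44, …. -/
/-- The Tribonacci-type sequence `1, 1, 2, 4, 7, 13, 24, 44, …`. -/
def tribonacci : ℕ → ℕ
  | 0 => 1
  | 1 => 1
  | 2 => 2
  | n + 3 => tribonacci (n + 2) + tribonacci (n + 1) + tribonacci n

namespace MvPolynomial

variable {σ R : Type*} [CommSemiring R]

theorem card_support_X_mul (s : σ) (p : MvPolynomial σ R) :
    (X s * p).support.card = p.support.card := by
  classical
  rw [support_X_mul, Finset.card_map]

theorem card_support_X_mul_add {s : σ} {q : MvPolynomial σ R} (hs : s ∉ q.vars)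
    (p : MvPolynomial σ R) :
    (X s * p + q).support.card = p.support.card + q.support.card := by
  classical
  have hd : Disjoint (X s * p).support q.support := by
    rw [Finset.disjoint_left]
    intro m hm hq
    rw [support_X_mul, Finset.mem_map] at hm
    obtain ⟨m', -, rfl⟩ := hm
    exact hs ((mem_vars_iff_mem_support s).2 ⟨_, hq, by simp⟩)
  have hadd : (X s * p + q).support = (X s * p).support ∪ q.support :=
    Finsupp.support_add_eq hd
  rw [hadd, Finset.card_union_of_disjoint hd, card_support_X_mul]

theorem vars_X_mul_subset [DecidableEq σ] [Nontrivial R] (s : σ) (p : MvPolynomial σ R) :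
    (X s * p).vars ⊆ insert s p.vars := by
  have h := vars_mul (X s) p
  rwa [vars_X, ← Finset.insert_eq] at h

end MvPolynomial

/-- In the polynomial ring over `ℤ` in three countable families of indeterminates
`aᵢ = X (0, i)`, `bᵢ = X (1, i)`, `dᵢ = X (2, i)`, the solution of the four-term recurrence
relation `c 0 = 1`, `c 1 = a₀`, `c 2 = a₀ a₁ + b₁`,
`c (n+1) = aₙ * c n + bₙ * c (n-1) + dₙ * c (n-2)` for `n ≥ 2`, has exactly `tribonacci n`
monomials: the number of individual terms follows the Tribonacci numbers
`1, 1, 2, 4, 7, 13, 24, 44, …`. -/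
theorem four_term_recurrence_term_count_tribonacci
    (c : ℕ → MvPolynomial (Fin 3 × ℕ) ℤ)
    (h0 : c 0 = 1)
    (h1 : c 1 = MvPolynomial.X (0, 0))
    (h2 : c 2 = MvPolynomial.X (0, 0) * MvPolynomial.X (0, 1) + MvPolynomial.X (1, 1))
    (hrec : ∀ n, 2 ≤ n → c (n + 1) =
      MvPolynomial.X (0, n) * c n + MvPolynomial.X (1, n) * c (n - 1) +
        MvPolynomial.X (2, n) * c (n - 2)) :
    ∀ n, (c n).support.card = tribonacci n := by
  have hvars : ∀ n, ∀ x ∈ (c n).vars, x.2 < n := by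
    intro n
    induction n using Nat.strong_induction_on with
    | _ n ih =>
      intro x hx
      match n with
      | 0 => simp [h0] at hx
      | 1 => simp_all [MvPolynomial.vars_X]
      | 2 =>
        rw [h2] at hx
        rcases Finset.mem_union.1 (MvPolynomial.vars_add_subset _ _ hx) with hx | hx
        · have := MvPolynomial.vars_X_mul_subset _ _ hx
          simp only [MvPolynomial.vars_X, Finset.mem_insert, Finset.mem_singleton] at this
          rcases this with rfl | rfl <;> simp
        · simp_all [MvPolynomial.vars_X]
      | n + 3 =>
        have key : ∀ (j : Fin 3) (k : ℕ), k < n + 3 →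
            x ∈ (MvPolynomial.X (j, n + 2) * c k).vars → x.2 < n + 3 := by
          intro j k hk h
          rcases Finset.mem_insert.1 (MvPolynomial.vars_X_mul_subset _ _ h) with rfl | h
          · simp
          · exact (ih k hk x h).trans hk
        rw [hrec (n + 2) (by omega)] at hx
        rcases Finset.mem_union.1 (MvPolynomial.vars_add_subset _ _ hx) with hx | hx
        · rcases Finset.mem_union.1 (MvPolynomial.vars_add_subset _ _ hx) with hx | hx
          · exact key _ _ (by omega) hx
          · exact key _ _ (by omega) hx
        · exact key _ _ (by omega) hx
  intro n
  induction n using tribonacci.induct with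
  | case1 => simp [h0, tribonacci]
  | case2 => simp [h1, tribonacci, MvPolynomial.support_X]
  | case3 =>
    rw [h2, MvPolynomial.card_support_X_mul_add (by simp [MvPolynomial.vars_X])]
    simp [tribonacci, MvPolynomial.support_X]
  | case4 n ih2 ih1 ih0 =>
    have hnot : ∀ (i j : Fin 3) (k : ℕ), i ≠ j → k ≤ n + 2 →
        (i, n + 2) ∉ (MvPolynomial.X (j, n + 2) * c k).vars := by
      intro i j k hij hk h
      rcases Finset.mem_insert.1 (MvPolynomial.vars_X_mul_subset _ _ h) with h | h
      · exact hij (congrArg Prod.fst h)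
      · exact absurd (hvars k _ h) (by simpa using hk)
    have hb := hnot 1 2 n (by decide) (by omega)
    have ha : (0, n + 2) ∉ (MvPolynomial.X (1, n + 2) * c (n + 1) +
        MvPolynomial.X (2, n + 2) * c n).vars := by
      intro h
      rcases Finset.mem_union.1 (MvPolynomial.vars_add_subset _ _ h) with h | h
      · exact hnot 0 1 (n + 1) (by decide) (by omega) h
      · exact hnot 0 2 n (by decide) (by omega) h
    have hc : c (n + 3) = MvPolynomial.X (0, n + 2) * c (n + 2) +
        (MvPolynomial.X (1, n + 2) * c (n + 1) + MvPolynomial.X (2, n + 2) * c n) := by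
      rw [← add_assoc]
      exact hrec (n + 2) (by omega)
    rw [hc, MvPolynomial.card_support_X_mul_add ha, MvPolynomial.card_support_X_mul_add hb,
      MvPolynomial.card_support_X_mul, ih2, ih1, ih0, tribonacci, add_assoc]
end

section
/- Work in the multivariate polynomial ring in four countable families of independent indeterminates a_i, b_i, d_i, e_i over ℤ (e.g. MvPolynomial (Fin 4 × ℕ) ℤ). Define c : ℕ → this ring by c 0 = 1, c 1 = a_0, c 2 = a_0 * a_1 + b_1, c 3 = a_0 * a_1 * a_2 + a_0 * b_2 + a_2 * b_1 + d_2, and c (n+1) = a_n * c n + b_n * c (n-1) + d_n * c (n-2) + e_n * c (n-3) for all n ≥ 3 (the five-term recurrence relation with seed values c_1 = A_0 c_0, c_2 = (A_0 A_1 + B_1) c_0, c_3 = (A_0 A_1 A_2 + A_0 B_2 + A_2 B_1 + C_2) c_0). Then for every n ≥ 0, the number of monomials of c n (the cardinality of its support) equals Q n, where Q 0 = 1, Q 1 = 1, Q 2 = 2, Q 3 = 4, and Q (n+1) = Q n + Q (n-1) + Q (n-2) + Q (n-3) for n ≥ 3. That is, the number of individual terms in the solution of the five-term recurrence relation follows the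 Tetranacci numbers 1, 1, 2, 4, 8, 15, 29, 56, 108, 208, …. -/
/-- The Tetranacci-type sequence `1, 1, 2, 4, 8, 15, 29, 56, 108, 208, …`. -/
def tetranacci : ℕ → ℕ
  | 0 => 1
  | 1 => 1
  | 2 => 2
  | 3 => 4
  | n + 4 => tetranacci (n + 3) + tetranacci (n + 2) + tetranacci (n + 1) + tetranacci n

namespace MvPolynomial

/-- A polynomial in the variables `X (k, i)` that involves only the variables with `i < n`. -/
def IndexLT {κ R : Type*} [CommSemiring R] (n : ℕ) (p : MvPolynomial (κ × ℕ) R) : Prop :=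
  ∀ m ∈ p.support, ∀ k i, n ≤ i → m (k, i) = 0

variable {κ R : Type*} [CommSemiring R] {n : ℕ}

theorem IndexLT.mono {n' : ℕ} {p : MvPolynomial (κ × ℕ) R} (hp : p.IndexLT n) (h : n ≤ n') :
    p.IndexLT n' :=
  fun m hm k i hi => hp m hm k i (h.trans hi)

theorem indexLT_zero : (0 : MvPolynomial (κ × ℕ) R).IndexLT n := by
  simp [IndexLT]

theorem indexLT_one : (1 : MvPolynomial (κ × ℕ) R).IndexLT n := by
  classical
  intro m hm k i _
  have h : 0 = m := by
    by_contra h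
    simp [coeff_one, h] at hm
  simp [← h]

theorem exists_of_mem_support_X_mul {σ : Type*} {s : σ} {p : MvPolynomial σ R} {m : σ →₀ ℕ}
    (hm : m ∈ (X s * p).support) : ∃ m' ∈ p.support, m = Finsupp.single s 1 + m' := by
  rw [support_X_mul, Finset.mem_map] at hm
  obtain ⟨m', hm', rfl⟩ := hm
  exact ⟨m', hm', rfl⟩

theorem IndexLT.sum_X_mul [Fintype κ] {p : κ → MvPolynomial (κ × ℕ) R}
    (hp : ∀ k, (p k).IndexLT n) : (∑ k, X (k, n) * p k).IndexLT (n + 1) := by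
  classical
  intro m hm j i hi
  obtain ⟨k, -, hk⟩ := Finset.mem_biUnion.1 (support_sum hm)
  obtain ⟨m', hm', rfl⟩ := exists_of_mem_support_X_mul hk
  have hne : (k, n) ≠ (j, i) := by
    intro h
    have := congrArg Prod.snd h
    dsimp at this
    omega
  simp [hne, hp k m' hm' j i (by omega)]

theorem disjoint_support_X_mul {p q : MvPolynomial (κ × ℕ) R} (hp : p.IndexLT n)
    (hq : q.IndexLT n) {k l : κ} (hkl : k ≠ l) :
    Disjoint (X (k, n) * p).support (X (l, n) * q).support := by
  classical
  rw [Finset.disjoint_left]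
  intro m hm hm'
  obtain ⟨u, hu, rfl⟩ := exists_of_mem_support_X_mul hm
  obtain ⟨v, hv, h⟩ := exists_of_mem_support_X_mul hm'
  have := DFunLike.congr_fun h (k, n)
  simp [hkl.symm, hp u hu k n le_rfl, hq v hv k n le_rfl] at this

theorem card_support_add_of_disjoint {σ : Type*} {p q : MvPolynomial σ R}
    (h : Disjoint p.support q.support) :
    (p + q).support.card = p.support.card + q.support.card := by
  classical
  have : (p + q).support = p.support ∪ q.support := by
    refine support_add.antisymm fun m hm => ?_
    rw [Finset.disjoint_left] at h
    have hm' := @h m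
    simp only [Finset.mem_union, mem_support_iff, coeff_add, not_not] at hm hm' ⊢
    by_cases hp : coeff m p = 0
    · simpa [hp] using hm
    · simpa [hm' hp] using hp
  rw [this, Finset.card_union_of_disjoint h]

theorem card_support_sum_X_mul [Fintype κ] {p : κ → MvPolynomial (κ × ℕ) R}
    (hp : ∀ k, (p k).IndexLT n) :
    (∑ k, X (k, n) * p k).support.card = ∑ k, (p k).support.card := by
  classical
  suffices ∀ s : Finset κ, (∑ k ∈ s, X (k, n) * p k).support.card = ∑ k ∈ s, (p k).support.card from
    this _
  intro s
  induction s using Finset.induction_on with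
  | empty => simp
  | insert k s hk ih =>
    rw [Finset.sum_insert hk, Finset.sum_insert hk, card_support_add_of_disjoint, ih,
      support_X_mul, Finset.card_map]
    rw [Finset.disjoint_left]
    intro m hm hm'
    obtain ⟨l, hl, hm'⟩ := Finset.mem_biUnion.1 (support_sum hm')
    exact Finset.disjoint_left.1
      (disjoint_support_X_mul (hp k) (hp l) (ne_of_mem_of_not_mem hl hk).symm) hm hm'

end MvPolynomial

/-- In the polynomial ring over `ℤ` in four countable families of indeterminates
`aᵢ = X (0, i)`, `bᵢ = X (1, i)`, `dᵢ = X (2, i)`, `eᵢ = X (3, i)`, the solution of the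
five-term recurrence relation `c 0 = 1`, `c 1 = a₀`, `c 2 = a₀ a₁ + b₁`,
`c 3 = a₀ a₁ a₂ + a₀ b₂ + a₂ b₁ + d₂`,
`c (n+1) = aₙ * c n + bₙ * c (n-1) + dₙ * c (n-2) + eₙ * c (n-3)` for `n ≥ 3`, has exactly
`tetranacci n` monomials: the number of individual terms follows the Tetranacci numbers
`1, 1, 2, 4, 8, 15, 29, 56, 108, 208, …`. -/
theorem five_term_recurrence_term_count_tetranacci
    (c : ℕ → MvPolynomial (Fin 4 × ℕ) ℤ)
    (h0 : c 0 = 1)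
    (h1 : c 1 = MvPolynomial.X (0, 0))
    (h2 : c 2 = MvPolynomial.X (0, 0) * MvPolynomial.X (0, 1) + MvPolynomial.X (1, 1))
    (h3 : c 3 = MvPolynomial.X (0, 0) * MvPolynomial.X (0, 1) * MvPolynomial.X (0, 2) +
      MvPolynomial.X (0, 0) * MvPolynomial.X (1, 2) +
      MvPolynomial.X (0, 2) * MvPolynomial.X (1, 1) + MvPolynomial.X (2, 2))
    (hrec : ∀ n, 3 ≤ n → c (n + 1) =
      MvPolynomial.X (0, n) * c n + MvPolynomial.X (1, n) * c (n - 1) +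
        MvPolynomial.X (2, n) * c (n - 2) + MvPolynomial.X (3, n) * c (n - 3)) :
    ∀ n, (c n).support.card = tetranacci n := by
  have h1' : c 1 = ∑ k, MvPolynomial.X (k, 0) * ![1, 0, 0, 0] k := by
    simp [h1, Fin.sum_univ_four]
  have h2' : c 2 = ∑ k, MvPolynomial.X (k, 1) * ![c 1, 1, 0, 0] k := by
    simp [h2, h1, Fin.sum_univ_four]; ring
  have h3' : c 3 = ∑ k, MvPolynomial.X (k, 2) * ![c 2, c 1, 1, 0] k := by
    simp [h3, h2, h1, Fin.sum_univ_four]; ring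
  have hrec' : ∀ n, c (n + 4) =
      ∑ k, MvPolynomial.X (k, n + 3) * ![c (n + 3), c (n + 2), c (n + 1), c n] k := by
    intro n
    simpa [Fin.sum_univ_four] using hrec (n + 3) (by omega)
  have i0 : (c 0).IndexLT 0 := h0 ▸ MvPolynomial.indexLT_one
  have p1 : ∀ k, (![1, 0, 0, 0] k : MvPolynomial (Fin 4 × ℕ) ℤ).IndexLT 0 := by
    simp [Fin.forall_fin_succ, MvPolynomial.indexLT_one, MvPolynomial.indexLT_zero]
  have i1 : (c 1).IndexLT 1 := h1' ▸ MvPolynomial.IndexLT.sum_X_mul p1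
  have p2 : ∀ k, (![c 1, 1, 0, 0] k).IndexLT 1 := by
    simp [Fin.forall_fin_succ, MvPolynomial.indexLT_one, MvPolynomial.indexLT_zero, i1]
  have i2 : (c 2).IndexLT 2 := h2' ▸ MvPolynomial.IndexLT.sum_X_mul p2
  have p3 : ∀ k, (![c 2, c 1, 1, 0] k).IndexLT 2 := by
    simp [Fin.forall_fin_succ, MvPolynomial.indexLT_one, MvPolynomial.indexLT_zero, i2,
      i1.mono one_le_two]
  have i3 : (c 3).IndexLT 3 := h3' ▸ MvPolynomial.IndexLT.sum_X_mul p3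
  have p4 : ∀ n, (c n).IndexLT n → (c (n + 1)).IndexLT (n + 1) → (c (n + 2)).IndexLT (n + 2) →
      (c (n + 3)).IndexLT (n + 3) →
      ∀ k, (![c (n + 3), c (n + 2), c (n + 1), c n] k).IndexLT (n + 3) := by
    intro n a b d e
    simp [Fin.forall_fin_succ, e, d.mono (show n + 2 ≤ n + 3 by omega),
      b.mono (show n + 1 ≤ n + 3 by omega), a.mono (show n ≤ n + 3 by omega)]
  have hi : ∀ n, (c n).IndexLT n := by
    intro n
    induction n using Nat.strong_induction_on with
    | _ n ih =>
      match n, ih with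
      | 0, _ => exact i0
      | 1, _ => exact i1
      | 2, _ => exact i2
      | 3, _ => exact i3
      | n + 4, ih =>
        rw [hrec']
        exact MvPolynomial.IndexLT.sum_X_mul (p4 n (ih _ (by omega)) (ih _ (by omega))
          (ih _ (by omega)) (ih _ (by omega)))
  have k1 : (c 1).support.card = 1 := by
    rw [h1', MvPolynomial.card_support_sum_X_mul p1]
    simp [Fin.sum_univ_four]
  have k2 : (c 2).support.card = 2 := by
    rw [h2', MvPolynomial.card_support_sum_X_mul p2]
    simp [Fin.sum_univ_four, k1]
  have k3 : (c 3).support.card = 4 := by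
    rw [h3', MvPolynomial.card_support_sum_X_mul p3]
    simp [Fin.sum_univ_four, k1, k2]
  intro n
  induction n using tetranacci.induct with
  | case1 => simp [h0, tetranacci]
  | case2 => rw [k1, tetranacci]
  | case3 => rw [k2, tetranacci]
  | case4 => rw [k3, tetranacci]
  | case5 n a b d e =>
    rw [hrec', MvPolynomial.card_support_sum_X_mul (p4 n (hi _) (hi _) (hi _) (hi _)), tetranacci]
    simp [Fin.sum_univ_four, a, b, d, e]
end
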